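/- Let f : G → G be a graph map and let ⟨x,y⟩ be a scrambled pair such that ω_f(x) is a solenoid. Then there exist points x*, y* ∈ G with x* ≠ y* such that ⟨x*,y*⟩ is an NS-pair; moreover x* and y* can be chosen with d(x*,y*) ≥ δ/2, where δ = limsup_{n→∞} d(f^n x, f^n y) > 0. -/

import Mathlib

open Set Filter Topology

/-- An arc in `X` with endpoints `a` and `b`: the image of a continuous injection
of `[0,1]` sending `0` to `a` and `1` to `b`. -/
def IsArcWithEnds {X : Type*} [TopologicalSpace X] (A : Set X) (a b : X) : Prop :=
  ∃ φ : Set.Icc (0:ℝ) 1 → X, Continuous φ ∧ Function.Injective φ ∧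
    Set.range φ = A ∧ φ ⟨0, by norm_num⟩ = a ∧ φ ⟨1, by norm_num⟩ = b

/-- A topological graph: a compact connected (metrizable) space which is a union of
finitely many arcs, any two of which are either disjoint or intersect in exactly one
common endpoint. -/
def IsTopGraph (X : Type*) [TopologicalSpace X] : Prop :=
  CompactSpace X ∧ ConnectedSpace X ∧
  ∃ (n : ℕ) (A : Fin n → Set X) (a b : Fin n → X),
    (∀ i, IsArcWithEnds (A i) (a i) (b i)) ∧
    (⋃ i, A i) = Set.univ ∧
    ∀ i j, i ≠ j →
      A i ∩ A j = ∅ ∨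
      ∃ p, A i ∩ A j = {p} ∧ p ∈ ({a i, b i} : Set X) ∧ p ∈ ({a j, b j} : Set X)

/-- A subgraph of `G`: a closed connected subset which is itself a topological graph. -/
def IsSubgraph {G : Type*} [TopologicalSpace G] (K : Set G) : Prop :=
  IsClosed K ∧ IsConnected K ∧ IsTopGraph ↥K

/-- A periodic subgraph with period `k`: `K, f(K), …, f^{k−1}(K)` are pairwise disjoint
and `f^k(K) = K`. -/
def IsPeriodicSubgraph {G : Type*} [TopologicalSpace G] (f : G → G) (K : Set G) (k : ℕ) :
    Prop :=
  IsSubgraph K ∧ 0 < k ∧ f^[k] '' K = K ∧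
    ∀ i j, i < k → j < k → i ≠ j → Disjoint (f^[i] '' K) (f^[j] '' K)

/-- A cycle of graphs with period `k`: the orbit `⋃_{i<k} f^i(K)` of a periodic
subgraph `K` with period `k`. -/
def IsCycleOfGraphs {G : Type*} [TopologicalSpace G] (f : G → G) (X : Set G) (k : ℕ) :
    Prop :=
  ∃ K, IsPeriodicSubgraph f K k ∧ X = ⋃ i ∈ Finset.range k, f^[i] '' K

/-- The ω-limit set of `x` under `f`. -/
def omegaSet {G : Type*} [TopologicalSpace G] (f : G → G) (x : G) : Set G :=
  ⋂ n : ℕ, closure ((fun m => f^[m] x) '' Set.Ici n)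

/-- `ω(f) = ⋃_{x} ω_f(x)`. -/
def omegaUnion {G : Type*} [TopologicalSpace G] (f : G → G) : Set G :=
  ⋃ x, omegaSet f x

/-- A set `W` is a solenoid for `f` if it is infinite and is contained in cycles of
graphs of arbitrarily large periods. -/
def IsSolenoid {G : Type*} [TopologicalSpace G] (f : G → G) (W : Set G) : Prop :=
  W.Infinite ∧ ∀ n : ℕ, ∃ X k, n ≤ k ∧ IsCycleOfGraphs f X k ∧ W ⊆ X

/-- Two points are separable if they belong to two disjoint periodic subgraphs. -/
def SeparablePoints {G : Type*} [TopologicalSpace G] (f : G → G) (x y : G) : Prop :=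
  ∃ I J kI kJ, IsPeriodicSubgraph f I kI ∧ IsPeriodicSubgraph f J kJ ∧
    Disjoint I J ∧ x ∈ I ∧ y ∈ J

/-- An NS-pair: a pair of distinct points of `ω(f)` contained in a nested sequence of
periodic subgraphs whose periods tend to infinity. -/
def IsNSPair {G : Type*} [TopologicalSpace G] (f : G → G) (x y : G) : Prop :=
  x ≠ y ∧ x ∈ omegaUnion f ∧ y ∈ omegaUnion f ∧
  ∃ (J : ℕ → Set G) (m : ℕ → ℕ),
    (∀ n, IsPeriodicSubgraph f (J n) (m n)) ∧
    (∀ n, J (n + 1) ⊆ J n) ∧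
    Filter.Tendsto m Filter.atTop Filter.atTop ∧
    ∀ n, x ∈ J n ∧ y ∈ J n

/-- The pair `⟨x,y⟩` is proximal. -/
def Proximal {G : Type*} [PseudoMetricSpace G] (f : G → G) (x y : G) : Prop :=
  ∀ ε > (0 : ℝ), ∀ N : ℕ, ∃ n ≥ N, dist (f^[n] x) (f^[n] y) < ε

/-- The pair `⟨x,y⟩` is asymptotic. -/
def Asymptotic {G : Type*} [PseudoMetricSpace G] (f : G → G) (x y : G) : Prop :=
  Filter.Tendsto (fun n => dist (f^[n] x) (f^[n] y)) Filter.atTop (nhds 0)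

/-- A scrambled pair is proximal but not asymptotic. -/
def ScrambledPair {G : Type*} [PseudoMetricSpace G] (f : G → G) (x y : G) : Prop :=
  Proximal f x y ∧ ¬ Asymptotic f x y

/-- Li–Yorke chaos: existence of an uncountable scrambled set. -/
def LiYorkeChaotic {G : Type*} [PseudoMetricSpace G] (f : G → G) : Prop :=
  ∃ S : Set G, ¬ S.Countable ∧ ∀ x ∈ S, ∀ y ∈ S, x ≠ y → ScrambledPair f x y

/-- `I ⊆ ℕ` is an independence set for the pair of sets `{A, B}`. -/
def IsIndepSet {G : Type*} (f : G → G) (A B : Set G) (I : Set ℕ) : Prop :=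
  ∀ J : Finset ℕ, ↑J ⊆ I → J.Nonempty → ∀ S : ℕ → Bool,
    (⋂ i ∈ J, f^[i] ⁻¹' (if S i then A else B)).Nonempty

/-- An IN-pair: every pair of neighborhoods has arbitrarily large finite
independence sets. -/
def IsINPair {G : Type*} [TopologicalSpace G] (f : G → G) (x y : G) : Prop :=
  ∀ U V : Set G, U ∈ nhds x → V ∈ nhds y →
    ∀ n : ℕ, ∃ I : Finset ℕ, n ≤ I.card ∧ IsIndepSet f U V ↑I

/-- An IT-pair: every pair of neighborhoods has an infinite independence set. -/
def IsITPair {G : Type*} [TopologicalSpace G] (f : G → G) (x y : G) : Prop :=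
  ∀ U V : Set G, U ∈ nhds x → V ∈ nhds y →
    ∃ I : Set ℕ, I.Infinite ∧ IsIndepSet f U V I

/-- The set of periodic points of `f`. -/
def PerPts {G : Type*} (f : G → G) : Set G :=
  {p | ∃ n ≥ 1, f^[n] p = p}

/-- A finite family of injective paths covering `G`, any two of which meet in at most one
point, which is then an endpoint of both. -/
structure ArcDecomposition (G : Type*) [TopologicalSpace G] (ι : Type*) where
  /-- the parametrizations of the arcs -/
  path : ι → unitInterval → G
  continuous_path : ∀ i, Continuous (path i)
  injective_path : ∀ i, Function.Injective (path i)
  cover : ∀ u, ∃ i s, path i s = u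
  eq_end_of_eq : ∀ i j s t, i ≠ j → path i s = path j t → s = 0 ∨ s = 1
  subsingleton_inter : ∀ i j, i ≠ j → (range (path i) ∩ range (path j)).Subsingleton

theorem IsTopGraph.exists_arcDecomposition {G : Type*} [TopologicalSpace G]
    (hG : IsTopGraph G) : ∃ n, Nonempty (ArcDecomposition G (Fin n)) := by
  obtain ⟨-, -, n, A, a, b, hA, hcov, hmeet⟩ := hG
  choose φ hφc hφi hφr hφa hφb using hA
  refine ⟨n, ⟨φ, hφc, hφi, fun u => ?_, fun i j s t hij h => ?_, fun i j hij => ?_⟩⟩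
  · obtain ⟨i, hi⟩ := mem_iUnion.1 (hcov.symm ▸ mem_univ u : u ∈ ⋃ i, A i)
    rw [← hφr i] at hi
    exact ⟨i, hi⟩
  · have hs : φ i s ∈ A i ∩ A j :=
      ⟨hφr i ▸ mem_range_self s, h ▸ hφr j ▸ mem_range_self t⟩
    rcases hmeet i j hij with h0 | ⟨p, hp, hpi, -⟩
    · simp [h0] at hs
    · rw [hp, mem_singleton_iff] at hs
      rw [← hs, mem_insert_iff, mem_singleton_iff, ← hφa i, ← hφb i] at hpi
      exact hpi.imp (fun e => hφi i e) (fun e => hφi i e)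
  · rw [hφr, hφr]
    rcases hmeet i j hij with h0 | ⟨p, hp, -⟩
    · simp [h0]
    · simp [hp]

/-- A set which is a finite union of order-connected sets. -/
def FiniteOrdConnectedUnion (S : Set unitInterval) : Prop :=
  ∃ T : Set (Set unitInterval), T.Finite ∧ (∀ t ∈ T, t.OrdConnected) ∧ ⋃₀ T = S

theorem Set.OrdConnected.finiteOrdConnectedUnion {S : Set unitInterval}
    (hS : S.OrdConnected) : FiniteOrdConnectedUnion S :=
  ⟨{S}, finite_singleton S, by simpa using hS, sUnion_singleton S⟩

namespace FiniteOrdConnectedUnion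

variable {S S' : Set unitInterval}

theorem union (h : FiniteOrdConnectedUnion S) (h' : FiniteOrdConnectedUnion S') :
    FiniteOrdConnectedUnion (S ∪ S') := by
  obtain ⟨T, hT, hc, rfl⟩ := h
  obtain ⟨T', hT', hc', rfl⟩ := h'
  exact ⟨T ∪ T', hT.union hT', fun t ht => ht.elim (hc t) (hc' t), sUnion_union T T'⟩

theorem inter (h : FiniteOrdConnectedUnion S) (h' : FiniteOrdConnectedUnion S') :
    FiniteOrdConnectedUnion (S ∩ S') := by
  obtain ⟨T, hT, hc, rfl⟩ := h
  obtain ⟨T', hT', hc', rfl⟩ := h'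
  refine ⟨image2 (· ∩ ·) T T', hT.image2 _ hT', ?_, ?_⟩
  · rintro _ ⟨t, ht, t', ht', rfl⟩
    exact (hc t ht).inter (hc' t' ht')
  · ext s
    simp only [mem_sUnion, mem_image2, mem_inter_iff]
    constructor
    · rintro ⟨_, ⟨t, ht, t', ht', rfl⟩, hs, hs'⟩
      exact ⟨⟨t, ht, hs⟩, t', ht', hs'⟩
    · rintro ⟨⟨t, ht, hs⟩, t', ht', hs'⟩
      exact ⟨_, ⟨t, ht, t', ht', rfl⟩, hs, hs'⟩

theorem finite_diff_interior (h : FiniteOrdConnectedUnion S) : (S \ interior S).Finite := by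
  obtain ⟨T, hT, hc, rfl⟩ := h
  refine (hT.biUnion (t := fun t => t \ interior t) fun t ht => ?_).subset ?_
  · have hl : {u | IsLeast t u}.Subsingleton := fun u hu v hv => hu.unique hv
    have hg : {u | IsGreatest t u}.Subsingleton := fun u hu v hv => hu.unique hv
    refine (hl.finite.union hg.finite).subset ?_
    rintro u ⟨hu, hui⟩
    by_contra hcon
    simp only [mem_union, mem_ofPred_eq, IsLeast, IsGreatest, hu, true_and, not_or,
      mem_lowerBounds, mem_upperBounds, not_forall, not_le] at hcon
    obtain ⟨⟨a, ha, hau⟩, b, hb, hub⟩ := hcon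
    exact hui (mem_interior.2 ⟨Ioo a b, Ioo_subset_Icc_self.trans ((hc t ht).out ha hb),
      isOpen_Ioo, hau, hub⟩)
  · rintro u ⟨⟨t, ht, hu⟩, hui⟩
    exact mem_biUnion ht ⟨hu, fun h => hui (interior_mono (subset_sUnion_of_mem ht) h)⟩

theorem finite_components (h : FiniteOrdConnectedUnion S) :
    (connectedComponentIn S '' S).Finite := by
  obtain ⟨T, hT, hc, rfl⟩ := h
  have key : ∀ t ∈ T, (connectedComponentIn (⋃₀ T) '' t).Finite := by
    intro t ht
    refine Subsingleton.finite ?_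
    rintro _ ⟨u, hu, rfl⟩ _ ⟨v, hv, rfl⟩
    exact connectedComponentIn_eq ((hc t ht).isPreconnected.subset_connectedComponentIn hu
      (subset_sUnion_of_mem ht) hv)
  refine (hT.biUnion key).subset ?_
  rintro _ ⟨u, ⟨t, ht, hu⟩, rfl⟩
  exact mem_biUnion ht ⟨u, hu, rfl⟩

end FiniteOrdConnectedUnion

theorem isClosed_connectedComponentIn {X : Type*} [TopologicalSpace X] {W : Set X}
    (hW : IsClosed W) (u : X) : IsClosed (connectedComponentIn W u) := by
  by_cases hu : u ∈ W
  · exact isClosed_of_closure_subset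
      (isPreconnected_connectedComponentIn.closure.subset_connectedComponentIn
        (subset_closure (mem_connectedComponentIn hu))
        (closure_minimal (connectedComponentIn_subset W u) hW))
  · simp [connectedComponentIn_eq_empty hu]

theorem exists_Icc_eq_connectedComponentIn {S : Set unitInterval} (hS : IsClosed S)
    {s : unitInterval} (hs : s ∈ S) : ∃ c d, c ≤ d ∧ connectedComponentIn S s = Icc c d := by
  set C := connectedComponentIn S s
  have hcl : IsClosed C := isClosed_connectedComponentIn hS s
  have hne : C.Nonempty := ⟨s, mem_connectedComponentIn hs⟩
  obtain ⟨c, hc⟩ := hcl.isCompact.exists_isLeast hne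
  obtain ⟨d, hd⟩ := hcl.isCompact.exists_isGreatest hne
  exact ⟨c, d, hc.2 hd.1, Subset.antisymm (fun u hu => ⟨hc.2 hu, hd.2 hu⟩)
    (isPreconnected_connectedComponentIn.ordConnected.out hc.1 hd.1)⟩

namespace ArcDecomposition

variable {G ι : Type*} [TopologicalSpace G] (D : ArcDecomposition G ι)

/-- A set meeting every arc in finitely many order-connected pieces. -/
def Tame (S : Set G) : Prop := ∀ i, FiniteOrdConnectedUnion (D.path i ⁻¹' S)

variable {D}

theorem tame_empty : D.Tame ∅ := fun _ => ordConnected_empty.finiteOrdConnectedUnion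

theorem tame_univ : D.Tame univ := fun _ => ordConnected_univ.finiteOrdConnectedUnion

theorem Tame.union {S S' : Set G} (h : D.Tame S) (h' : D.Tame S') : D.Tame (S ∪ S') :=
  fun i => (h i).union (h' i)

theorem Tame.inter {S S' : Set G} (h : D.Tame S) (h' : D.Tame S') : D.Tame (S ∩ S') :=
  fun i => (h i).inter (h' i)

theorem tame_biUnion_range {S : ℕ → Set G} (h : ∀ n, D.Tame (S n)) (k : ℕ) :
    D.Tame (⋃ i ∈ Finset.range k, S i) := by
  induction k with
  | zero => simpa using tame_empty
  | succ k ih =>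
    rw [Finset.range_add_one, Finset.set_biUnion_insert]
    exact (h k).union ih

theorem tame_biInter_range {S : ℕ → Set G} (h : ∀ n, D.Tame (S n)) (k : ℕ) :
    D.Tame (⋂ i ∈ Finset.range k, S i) := by
  induction k with
  | zero => simpa using tame_univ
  | succ k ih =>
    rw [Finset.range_add_one, Finset.set_biInter_insert]
    exact (h k).inter ih

theorem Tame.exists_preconnected [Finite ι] {S : Set G} (h : D.Tame S) :
    ∃ T : Set (Set G), T.Finite ∧ (∀ t ∈ T, IsPreconnected t) ∧ ⋃₀ T = S := by
  choose T hT hc hU using h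
  refine ⟨⋃ i, image (D.path i) '' T i, finite_iUnion fun i => (hT i).image _, ?_, ?_⟩
  · simp only [mem_iUnion, mem_image]
    rintro _ ⟨i, t, ht, rfl⟩
    exact (hc i t ht).isPreconnected.image _ (D.continuous_path i).continuousOn
  · ext u
    constructor
    · rintro ⟨r, hr, hu⟩
      obtain ⟨i, t, ht, rfl⟩ := mem_iUnion.1 hr
      obtain ⟨s, hs, rfl⟩ := hu
      exact (hU i).subset ⟨t, ht, hs⟩
    · intro hu
      obtain ⟨i, s, rfl⟩ := D.cover u
      obtain ⟨t, ht, hs⟩ := (hU i).superset hu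
      exact ⟨D.path i '' t, mem_iUnion.2 ⟨i, t, ht, rfl⟩, s, hs, rfl⟩

variable [T2Space G]

variable (D) in
theorem isOpen_image [Finite ι] (i : ι) {V : Set unitInterval} (hV : IsOpen V)
    (hV01 : V ⊆ Ioo 0 1) : IsOpen (D.path i '' V) := by
  have hcl : IsClosed (D.path i '' Vᶜ ∪ ⋃ j : {j // j ≠ i}, range (D.path j)) :=
    (hV.isClosed_compl.isCompact.image (D.continuous_path i)).isClosed.union
      (isClosed_iUnion_of_finite fun j => (isCompact_range (D.continuous_path j)).isClosed)
  have : D.path i '' V = (D.path i '' Vᶜ ∪ ⋃ j : {j // j ≠ i}, range (D.path j))ᶜ := by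
    ext u
    simp only [mem_compl_iff, mem_union, mem_iUnion, not_or, not_exists]
    constructor
    · rintro ⟨s, hs, rfl⟩
      refine ⟨?_, ?_⟩
      · rintro ⟨t, ht, hts⟩
        exact ht (D.injective_path i hts ▸ hs)
      · rintro ⟨j, hj⟩ ⟨t, ht⟩
        rcases D.eq_end_of_eq i j s t (Ne.symm hj) ht.symm with rfl | rfl
        · exact lt_irrefl _ (hV01 hs).1
        · exact lt_irrefl _ (hV01 hs).2
    · rintro ⟨h1, h2⟩
      obtain ⟨j, s, rfl⟩ := D.cover u
      obtain rfl : j = i := by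
        by_contra hj
        exact h2 ⟨j, hj⟩ ⟨s, rfl⟩
      by_contra hs
      exact h1 ⟨s, fun h => hs ⟨s, h, rfl⟩, rfl⟩
  rw [this]
  exact hcl.isOpen_compl

theorem Tame.finite_diff_interior [Finite ι] {S : Set G} (h : D.Tame S) :
    (S \ interior S).Finite := by
  have hfin : (⋃ i, D.path i '' ({0, 1} ∪ (D.path i ⁻¹' S) \ interior (D.path i ⁻¹' S))).Finite :=
    finite_iUnion fun i => ((toFinite _).union (h i).finite_diff_interior).image _
  refine hfin.subset ?_
  rintro u ⟨hu, hui⟩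
  obtain ⟨i, s, rfl⟩ := D.cover u
  refine mem_iUnion.2 ⟨i, s, ?_, rfl⟩
  by_contra hcon
  simp only [mem_union, mem_insert_iff, mem_singleton_iff, Set.mem_sdiff, mem_preimage, hu, true_and,
    not_or, not_not] at hcon
  obtain ⟨⟨h0, h1⟩, hs⟩ := hcon
  refine hui (mem_interior.2 ⟨D.path i '' (interior (D.path i ⁻¹' S) ∩ Ioo 0 1), ?_,
    D.isOpen_image i (isOpen_interior.inter isOpen_Ioo) inter_subset_right,
    s, ⟨hs, unitInterval.pos_iff_ne_zero.2 h0, unitInterval.lt_one_iff_ne_one.2 h1⟩, rfl⟩)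
  rintro _ ⟨t, ht, rfl⟩
  exact (interior_subset ht.1 : t ∈ D.path i ⁻¹' S)

theorem tame_of_isPreconnected [Finite ι] {K : Set G}
    (hK : IsPreconnected K) : D.Tame K := by
  intro i
  set S := D.path i ⁻¹' K with hS
  by_cases hin : K ⊆ D.path i '' Ioo 0 1
  · exact (hK.preimage_of_isClosedMap (D.injective_path i) (D.continuous_path i).isClosedMap
      (hin.trans (image_subset_range _ _))).ordConnected.finiteOrdConnectedUnion
  have key : ∀ s ∈ S, Iic s ⊆ S ∨ Ici s ⊆ S := by
    intro s hs
    by_contra hcon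
    simp only [not_or, not_subset, mem_Iic, mem_Ici] at hcon
    obtain ⟨⟨a, has, ha⟩, b, hsb, hb⟩ := hcon
    have has' : a < s := lt_of_le_of_ne has fun e => ha (e ▸ hs)
    have hsb' : s < b := lt_of_le_of_ne hsb fun e => hb (e ▸ hs)
    have hsub : Ioo a b ⊆ Ioo 0 1 := fun t ht =>
      ⟨lt_of_le_of_lt unitInterval.nonneg' ht.1, lt_of_lt_of_le ht.2 unitInterval.le_one'⟩
    refine hin ((hK.subset_left_of_subset_union (D.isOpen_image i isOpen_Ioo hsub)
      (v := (D.path i '' Icc a b)ᶜ)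
      (isCompact_Icc.image (D.continuous_path i)).isClosed.isOpen_compl ?_ ?_
      ⟨_, hs, s, ⟨has', hsb'⟩, rfl⟩).trans (image_mono hsub))
    · exact disjoint_compl_right.mono_left (image_mono Ioo_subset_Icc_self)
    · intro u hu
      by_cases hu' : u ∈ D.path i '' Icc a b
      · obtain ⟨t, ht, rfl⟩ := hu'
        exact Or.inl ⟨t, ⟨lt_of_le_of_ne ht.1 fun e => ha (e ▸ hu),
          lt_of_le_of_ne ht.2 fun e => hb (e ▸ hu)⟩, rfl⟩
      · exact Or.inr hu'
  have hPQ : S = {s | Iic s ⊆ S} ∪ {s | Ici s ⊆ S} := by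
    ext s
    exact ⟨key s, fun h => h.elim (fun h => h self_mem_Iic) fun h => h self_mem_Ici⟩
  rw [hPQ]
  refine FiniteOrdConnectedUnion.union ?_ ?_
  · exact IsLowerSet.ordConnected (s := {s | Iic s ⊆ S})
      (fun a b hba ha => (Iic_subset_Iic.2 hba).trans ha) |>.finiteOrdConnectedUnion
  · exact IsUpperSet.ordConnected (s := {s | Ici s ⊆ S})
      (fun a b hab ha => (Ici_subset_Ici.2 hab).trans ha) |>.finiteOrdConnectedUnion

theorem exists_path_range_eq_Icc {c d : unitInterval} (h : c < d) :
    ∃ σ : unitInterval → unitInterval, Continuous σ ∧ Function.Injective σ ∧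
      range σ = Icc c d ∧ σ 0 = c ∧ σ 1 = d := by
  have hcd : (0 : ℝ) < d - c := sub_pos.2 h
  have hmem : ∀ s : unitInterval, (c : ℝ) + s * (d - c) ∈ Icc (c : ℝ) d := fun s =>
    ⟨by nlinarith [s.2.1, s.2.2], by nlinarith [s.2.1, s.2.2]⟩
  refine ⟨fun s => ⟨c + s * (d - c), c.2.1.trans (hmem s).1, (hmem s).2.trans d.2.2⟩,
    by fun_prop, ?_, ?_, ?_, ?_⟩
  · intro s t hst
    have hst' : (c : ℝ) + s * (d - c) = c + t * (d - c) := congrArg Subtype.val hst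
    exact Subtype.ext (mul_right_cancel₀ hcd.ne' (add_left_cancel hst'))
  · ext t
    constructor
    · rintro ⟨s, rfl⟩
      exact hmem s
    · rintro ⟨h1, h2⟩
      have h1' : (c : ℝ) ≤ t := h1
      have h2' : (t : ℝ) ≤ d := h2
      refine ⟨⟨(t - c) / (d - c), div_nonneg (sub_nonneg.2 h1') hcd.le,
        (div_le_one hcd).2 (by linarith)⟩, Subtype.ext ?_⟩
      simp [div_mul_cancel₀ _ hcd.ne']
  · simp
  · simp

theorem isTopGraph_of_finite_arcs {X κ : Type*} [TopologicalSpace X] [CompactSpace X]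
    [ConnectedSpace X] [Finite κ] (A : κ → Set X) (a b : κ → X)
    (hA : ∀ q, IsArcWithEnds (A q) (a q) (b q)) (hcov : ⋃ q, A q = univ)
    (hmeet : ∀ q r, q ≠ r → A q ∩ A r = ∅ ∨
      ∃ p, A q ∩ A r = {p} ∧ p ∈ ({a q, b q} : Set X) ∧ p ∈ ({a r, b r} : Set X)) :
    IsTopGraph X := by
  obtain ⟨n, ⟨e⟩⟩ := Finite.exists_equiv_fin κ
  exact ⟨inferInstance, inferInstance, n, A ∘ e.symm, a ∘ e.symm, b ∘ e.symm,
    fun i => hA _, (e.symm.surjective.iUnion_comp A).trans hcov,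
    fun i j hij => hmeet _ _ (e.symm.injective.ne hij)⟩

theorem Tame.isSubgraph [Finite ι] [CompactSpace G] {J : Set G} (hJ : D.Tame J)
    (hcl : IsClosed J) (hconn : IsConnected J) (hnt : J.Nontrivial) : IsSubgraph J := by
  let S : ι → Set unitInterval := fun i => D.path i ⁻¹' J
  have hScl : ∀ i, IsClosed (S i) := fun i => hcl.preimage (D.continuous_path i)
  let κ := {q : ι × Set unitInterval //
    q.2 ∈ connectedComponentIn (S q.1) '' S q.1 ∧ q.2.Nontrivial}
  have hκ : Finite κ := by
    refine Set.Finite.subset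
      (finite_iUnion fun i => (hJ i).finite_components.image (Prod.mk i)) ?_
    rintro ⟨i, C⟩ ⟨hC, -⟩
    exact mem_iUnion.2 ⟨i, C, hC, rfl⟩
  have hIcc : ∀ q : κ, ∃ c d, c < d ∧ q.1.2 = Icc c d := by
    rintro ⟨⟨i, C⟩, ⟨s, hs, hsC⟩, hC⟩
    obtain ⟨c, d, -, h⟩ := exists_Icc_eq_connectedComponentIn (hScl i) hs
    refine ⟨c, d, ?_, hsC.symm.trans h⟩
    by_contra hcd
    rw [← hsC, h] at hC
    exact not_subsingleton_iff.2 hC (subsingleton_Icc_of_ge (not_lt.1 hcd))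
  choose c d hcd hC using hIcc
  choose σ hσc hσi hσr hσ0 hσ1 using fun q => exists_path_range_eq_Icc (hcd q)
  have hsub : ∀ q : κ, q.1.2 ⊆ S q.1.1 := by
    rintro ⟨⟨i, C⟩, ⟨s, hs, hsC⟩, hC⟩
    exact (Eq.symm hsC : C = _).subset.trans (connectedComponentIn_subset _ _)
  have hmem : ∀ q s, D.path q.1.1 (σ q s) ∈ J := fun q s =>
    hsub q (by rw [hC, ← hσr]; exact mem_range_self s)
  let ψ : κ → unitInterval → J := fun q s => ⟨D.path q.1.1 (σ q s), hmem q s⟩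
  have hψc : ∀ q, Continuous (ψ q) := fun q =>
    ((D.continuous_path _).comp (hσc q)).subtype_mk _
  have hψi : ∀ q, Function.Injective (ψ q) := fun q s t h =>
    hσi q (D.injective_path _ (congrArg Subtype.val h))
  have hend : ∀ q s, σ q s = 0 ∨ σ q s = 1 → ψ q s = ψ q 0 ∨ ψ q s = ψ q 1 := by
    intro q s hs
    have hs' : σ q s ∈ Icc (c q) (d q) := hσr q ▸ mem_range_self s
    rcases hs with h | h
    · left
      refine congrArg (ψ q) (hσi q ?_)
      rw [h, hσ0]
      exact le_antisymm unitInterval.nonneg' (h ▸ hs'.1)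
    · right
      refine congrArg (ψ q) (hσi q ?_)
      rw [h, hσ1]
      exact le_antisymm (h ▸ hs'.2) unitInterval.le_one'
  have : CompactSpace J := isCompact_iff_compactSpace.1 hcl.isCompact
  have : ConnectedSpace J := isConnected_iff_connectedSpace.1 hconn
  have : Nontrivial J := hnt.coe_sort
  refine ⟨hcl, hconn, isTopGraph_of_finite_arcs (fun q => range (ψ q)) (fun q => ψ q 0)
    (fun q => ψ q 1) (fun q => ⟨ψ q, hψc q, hψi q, rfl, rfl, rfl⟩) ?_ ?_⟩
  · by_contra hne
    obtain ⟨u, hu⟩ := (ne_univ_iff_exists_notMem _).1 hne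
    have hopen : IsOpen (⋃ q, range (ψ q))ᶜ :=
      (isClosed_iUnion_of_finite fun q => (isCompact_range (hψc q)).isClosed).isOpen_compl
    refine infinite_of_mem_nhds u (hopen.mem_nhds hu) (Finite.of_finite_image ?_
      (Subtype.val_injective.injOn (s := (⋃ q, range (ψ q))ᶜ)))
    have hfin : ∀ i, {s ∈ S i | (connectedComponentIn (S i) s).Subsingleton}.Finite := by
      intro i
      refine Finite.of_finite_image (f := connectedComponentIn (S i))
        ((hJ i).finite_components.subset (image_mono fun s hs => hs.1)) ?_
      intro s hs t ht hst
      exact hs.2 (mem_connectedComponentIn hs.1)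
        (hst ▸ mem_connectedComponentIn ht.1)
    refine (finite_iUnion fun i => (hfin i).image (D.path i)).subset ?_
    rintro _ ⟨⟨v, hv⟩, hvA, rfl⟩
    obtain ⟨i, s, rfl⟩ := D.cover v
    refine mem_iUnion.2 ⟨i, s, ⟨hv, ?_⟩, rfl⟩
    by_contra hC'
    let q : κ := ⟨(i, connectedComponentIn (S i) s), ⟨s, hv, rfl⟩, not_subsingleton_iff.1 hC'⟩
    have hs : s ∈ range (σ q) := by
      rw [hσr, ← hC]
      exact mem_connectedComponentIn hv
    obtain ⟨t, ht⟩ := hs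
    exact hvA (mem_iUnion.2 ⟨q, t, Subtype.ext (congrArg (D.path i) ht)⟩)
  · intro q r hqr
    rcases (range (ψ q) ∩ range (ψ r)).eq_empty_or_nonempty with h | ⟨p, hp⟩
    · exact Or.inl h
    right
    obtain ⟨⟨s, hs⟩, t, ht⟩ := hp
    have hst : D.path q.1.1 (σ q s) = D.path r.1.1 (σ r t) :=
      congrArg Subtype.val (hs.trans ht.symm)
    have hij : q.1.1 ≠ r.1.1 := by
      intro hij
      refine hqr (Subtype.ext (Prod.ext hij ?_))
      have hst' : σ q s = σ r t := D.injective_path _ (hst.trans (by rw [hij]))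
      have hsq : σ q s ∈ q.1.2 := by rw [hC, ← hσr]; exact mem_range_self s
      have htr : σ q s ∈ r.1.2 := by rw [hst', hC, ← hσr]; exact mem_range_self t
      obtain ⟨u, -, hu⟩ := q.2.1
      obtain ⟨v, -, hv⟩ := r.2.1
      rw [← hu] at hsq
      rw [← hv] at htr
      rw [← hu, ← hv, connectedComponentIn_eq hsq, connectedComponentIn_eq htr, hij]
    refine ⟨p, Subset.antisymm ?_ (singleton_subset_iff.2 ⟨⟨s, hs⟩, t, ht⟩), ?_, ?_⟩
    · rintro v ⟨⟨s', hs'⟩, t', ht'⟩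
      rw [← hs'] at ht'
      rw [mem_singleton_iff, ← hs, ← hs']
      exact Subtype.ext (D.subsingleton_inter _ _ hij
        ⟨mem_range_self _, _, congrArg Subtype.val ht'⟩ ⟨mem_range_self _, _, hst.symm⟩)
    · rw [← hs]
      exact hend q s (D.eq_end_of_eq _ _ _ _ hij hst)
    · rw [← ht]
      exact hend r t (D.eq_end_of_eq _ _ _ _ hij.symm hst.symm)

end ArcDecomposition

section Iterates

variable {G : Type*} {f : G → G}

theorem image_iterate_add (f : G → G) (a b : ℕ) (K : Set G) :
    f^[a + b] '' K = f^[a] '' (f^[b] '' K) := by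
  rw [Function.iterate_add, image_comp]

theorem mapsTo_iterate_mul {C : Set G} {p : ℕ} (h : MapsTo f^[p] C C) (m : ℕ) :
    MapsTo f^[p * m] C C := by
  rw [Function.iterate_mul]
  exact h.iterate m

theorem antitone_image_iterate_mul {C : Set G} {p : ℕ} (h : MapsTo f^[p] C C) :
    Antitone fun m => f^[p * m] '' C :=
  antitone_nat_of_succ_le fun m => by
    rw [Nat.mul_succ, image_iterate_add]
    exact image_mono h.image_subset

end Iterates

section Antitone

variable {X : Type*} [TopologicalSpace X] [CompactSpace X] [T2Space X] {K : ℕ → Set X}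

theorem isPreconnected_iInter_of_antitone (hK : Antitone K) (hcl : ∀ n, IsClosed (K n))
    (hc : ∀ n, IsPreconnected (K n)) : IsPreconnected (⋂ n, K n) := by
  refine (isPreconnected_iff_subset_of_fully_disjoint_closed (isClosed_iInter hcl)).2 ?_
  intro u v hu hv huv hdisj
  obtain ⟨U, V, hU, hV, huU, hvV, hUV⟩ := normal_separation hu hv hdisj
  obtain ⟨n, hn⟩ : ∃ n, K n ⊆ U ∪ V := by
    by_contra! hcon
    have hne := IsCompact.nonempty_iInter_of_sequence_nonempty_isCompact_isClosed
      (fun n => K n \ (U ∪ V)) (fun n => sdiff_subset_sdiff_left (hK n.le_succ))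
      (fun n => sdiff_nonempty.2 (hcon n))
      (((hcl 0).sdiff (hU.union hV)).isCompact) (fun n => (hcl n).sdiff (hU.union hV))
    obtain ⟨a, ha⟩ := hne
    rw [mem_iInter] at ha
    exact (ha 0).2 (union_subset_union huU hvV (huv (mem_iInter.2 fun n => (ha n).1)))
  rcases (hc n).subset_or_subset hU hV hUV hn with h | h
  · left
    intro a ha
    exact (huv ha).resolve_right fun hav =>
      disjoint_left.1 hUV (h (mem_iInter.1 ha n)) (hvV hav)
  · right
    intro a ha
    exact (huv ha).resolve_left fun hau =>
      disjoint_left.1 hUV (huU hau) (h (mem_iInter.1 ha n))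

theorem image_iInter_of_antitone {g : X → X} (hg : Continuous g) (hK : Antitone K)
    (hcl : ∀ n, IsClosed (K n)) : g '' (⋂ n, K n) = ⋂ n, g '' K n := by
  refine Subset.antisymm (image_iInter_subset _ _) fun v hv => ?_
  rw [mem_iInter] at hv
  have hpre : IsClosed (g ⁻¹' {v}) := isClosed_singleton.preimage hg
  obtain ⟨a, ha⟩ := IsCompact.nonempty_iInter_of_sequence_nonempty_isCompact_isClosed
    (fun n => K n ∩ g ⁻¹' {v}) (fun n => inter_subset_inter_left _ (hK n.le_succ))
    (fun n => (hv n).imp fun a ha => ha) (((hcl 0).inter hpre).isCompact)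
    (fun n => (hcl n).inter hpre)
  rw [mem_iInter] at ha
  exact ⟨a, mem_iInter.2 fun n => (ha n).1, (ha 0).2⟩

end Antitone

section Cycles

variable {G : Type*} [TopologicalSpace G] {f : G → G} {K X : Set G} {k : ℕ}

theorem IsPeriodicSubgraph.image_iterate_mod (h : IsPeriodicSubgraph f K k) (m : ℕ) :
    f^[m % k] '' K = f^[m] '' K := by
  have hper : Function.IsPeriodicPt (image f) k K := by
    simpa [Function.IsPeriodicPt, Function.IsFixedPt, ← Set.image_iterate_eq] using h.2.2.1
  simpa [← Set.image_iterate_eq] using hper.iterate_mod_apply m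

theorem IsPeriodicSubgraph.modEq_of_mem (h : IsPeriodicSubgraph f K k) {a b : ℕ} {u : G}
    (ha : u ∈ f^[a] '' K) (hb : u ∈ f^[b] '' K) : a ≡ b [MOD k] := by
  by_contra hne
  rw [← h.image_iterate_mod] at ha hb
  exact disjoint_left.1 (h.2.2.2 _ _ (Nat.mod_lt _ h.2.1) (Nat.mod_lt _ h.2.1) hne) ha hb

theorem IsCycleOfGraphs.mapsTo (h : IsCycleOfGraphs f X k) : MapsTo f X X := by
  obtain ⟨K, hK, rfl⟩ := h
  intro u hu
  simp only [mem_iUnion, Finset.mem_range] at hu ⊢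
  obtain ⟨i, -, hi⟩ := hu
  refine ⟨(1 + i) % k, Nat.mod_lt _ hK.2.1, ?_⟩
  rw [hK.image_iterate_mod, image_iterate_add]
  exact mem_image_of_mem _ hi

theorem IsPeriodicSubgraph.isClosed_image_iterate [CompactSpace G] [T2Space G]
    (h : IsPeriodicSubgraph f K k) (hf : Continuous f) (i : ℕ) : IsClosed (f^[i] '' K) :=
  (h.1.1.isCompact.image (hf.iterate i)).isClosed

theorem IsCycleOfGraphs.isClosed [CompactSpace G] [T2Space G]
    (h : IsCycleOfGraphs f X k) (hf : Continuous f) : IsClosed X := by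
  obtain ⟨K, hK, rfl⟩ := h
  exact isClosed_biUnion_finset fun i _ => hK.isClosed_image_iterate hf i

theorem IsCycleOfGraphs.tame [T2Space G] {ι : Type*} [Finite ι]
    (h : IsCycleOfGraphs f X k) (hf : Continuous f) (D : ArcDecomposition G ι) : D.Tame X := by
  obtain ⟨K, hK, rfl⟩ := h
  exact ArcDecomposition.tame_biUnion_range (fun i =>
    ArcDecomposition.tame_of_isPreconnected
      (hK.1.2.1.isPreconnected.image _ (hf.iterate i).continuousOn)) k

theorem IsCycleOfGraphs.le_of_mapsTo [CompactSpace G] [T2Space G]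
    (h : IsCycleOfGraphs f X k) (hf : Continuous f) {C : Set G} (hC : IsPreconnected C)
    (hne : C.Nonempty) (hCX : C ⊆ X) {p : ℕ} (hp : 0 < p) (hpC : MapsTo f^[p] C C) :
    k ≤ p := by
  obtain ⟨K, hK, rfl⟩ := h
  obtain ⟨u, hu⟩ := hne
  obtain ⟨i, hik, hi⟩ : ∃ i < k, u ∈ f^[i] '' K := by
    simpa only [mem_iUnion, Finset.mem_range, exists_prop] using hCX hu
  have hCi : C ⊆ f^[i] '' K := by
    have hcover : C ⊆ f^[i] '' K ∪ ⋃ j ∈ (Finset.range k).erase i, f^[j] '' K := by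
      intro v hv
      obtain ⟨j, hj, hj'⟩ := mem_iUnion₂.1 (hCX hv)
      by_cases hji : j = i
      · exact Or.inl (hji ▸ hj')
      · exact Or.inr (mem_iUnion₂.2 ⟨j, Finset.mem_erase.2 ⟨hji, hj⟩, hj'⟩)
    have hdisj : Disjoint (f^[i] '' K) (⋃ j ∈ (Finset.range k).erase i, f^[j] '' K) := by
      refine disjoint_iUnion₂_right.2 fun j hj => ?_
      rw [Finset.mem_erase, Finset.mem_range] at hj
      exact hK.2.2.2 i j hik hj.2 hj.1.symm
    refine (isPreconnected_iff_subset_of_disjoint_closed.1 hC _ _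
      (hK.isClosed_image_iterate hf i)
      (isClosed_biUnion_finset fun j _ => hK.isClosed_image_iterate hf j) hcover
      (by rw [hdisj.inter_eq, inter_empty])).resolve_right fun h => ?_
    exact disjoint_left.1 hdisj hi (h hu)
  have h1 : f^[p] u ∈ f^[p + i] '' K := by
    rw [image_iterate_add]
    exact mem_image_of_mem _ hi
  have h2 : p + i ≡ 0 + i [MOD k] := by
    simpa using hK.modEq_of_mem h1 (hCi (hpC hu))
  exact Nat.le_of_dvd hp ((Nat.modEq_zero_iff_dvd).1 (Nat.ModEq.add_right_cancel' i h2))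

end Cycles

section Components

variable {G : Type*} [TopologicalSpace G] {f : G → G} {W : Set G} {u a : G}

theorem mapsTo_iterate_connectedComponentIn (hf : Continuous f) (hW : MapsTo f W W)
    (hu : u ∈ W) (m : ℕ) :
    MapsTo f^[m] (connectedComponentIn W u) (connectedComponentIn W (f^[m] u)) :=
  ((hf.iterate m).continuousOn.mapsTo_connectedComponentIn hu).mono_right
    (connectedComponentIn_mono _ (hW.iterate m).image_subset)

theorem mapsTo_iterate_connectedComponentIn_self (hf : Continuous f) (hW : MapsTo f W W)
    {m : ℕ} (ha : a ∈ connectedComponentIn W u) (hm : f^[m] a ∈ connectedComponentIn W u) :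
    MapsTo f^[m] (connectedComponentIn W u) (connectedComponentIn W u) := by
  have h := mapsTo_iterate_connectedComponentIn hf hW (connectedComponentIn_subset W u ha) m
  rwa [← connectedComponentIn_eq ha, ← connectedComponentIn_eq hm] at h

theorem connectedComponentIn_mem_nhdsWithin (hW : IsClosed W) {T : Set (Set G)}
    (hT : T.Finite) (hc : ∀ t ∈ T, IsPreconnected t) (hTW : ⋃₀ T = W) :
    connectedComponentIn W u ∈ 𝓝[W] u := by
  have key : ∀ t ∈ T, ∀ᶠ v in 𝓝 u, v ∈ t → v ∈ connectedComponentIn W u := by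
    intro t ht
    by_cases hu : u ∈ closure t
    · exact Eventually.of_forall fun v hv => (hc t ht).closure.subset_connectedComponentIn hu
        (closure_minimal ((subset_sUnion_of_mem ht).trans hTW.subset) hW) (subset_closure hv)
    · filter_upwards [isClosed_closure.isOpen_compl.mem_nhds hu] with v hv hvt
      exact absurd (subset_closure hvt) hv
  refine mem_nhdsWithin_iff_eventually.2 ?_
  filter_upwards [(eventually_all_finite hT).2 key] with v hv hvW
  obtain ⟨t, ht, hvt⟩ := hTW.superset hvW
  exact hv t ht hvt

/-- The part of the component of `u` in `W` on which `f^[p]` is surjective. -/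
def componentCore (f : G → G) (W : Set G) (u : G) (p : ℕ) : Set G :=
  ⋂ m : ℕ, f^[p * m] '' connectedComponentIn W u

theorem componentCore_subset (p : ℕ) : componentCore f W u p ⊆ connectedComponentIn W u :=
  (iInter_subset _ 0).trans (by simp)

theorem componentCore_anti {W' : Set G} (hW : W' ⊆ W) {p p' : ℕ} (hp' : 0 < p')
    (hp : MapsTo f^[p] (connectedComponentIn W u) (connectedComponentIn W u)) :
    componentCore f W' u p' ⊆ componentCore f W u p := by
  intro v hv
  refine mem_iInter.2 fun m => ?_
  obtain ⟨e, rfl⟩ := Nat.exists_eq_add_of_lt hp'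
  obtain ⟨a, ha, rfl⟩ := mem_iInter.1 hv (p * m)
  refine ⟨f^[p * (m * e)] a,
    mapsTo_iterate_mul hp _ (connectedComponentIn_mono u hW ha), ?_⟩
  rw [← Function.iterate_add_apply]
  congr 2
  ring

/-- `p` is the first positive time at which `f` maps the component of `u` in `W` into itself. -/
def IsFirstReturn (f : G → G) (W : Set G) (u : G) (p : ℕ) : Prop :=
  0 < p ∧ MapsTo f^[p] (connectedComponentIn W u) (connectedComponentIn W u) ∧
    ∀ r, 0 < r → MapsTo f^[r] (connectedComponentIn W u) (connectedComponentIn W u) → p ≤ r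

theorem IsFirstReturn.disjoint_images {p : ℕ} (hp : IsFirstReturn f W u p)
    (hf : Continuous f) (hW : MapsTo f W W) {i j : ℕ} (hi : i < p) (hj : j < p) (hij : i ≠ j) :
    Disjoint (f^[i] '' connectedComponentIn W u) (f^[j] '' connectedComponentIn W u) := by
  wlog h : i < j generalizing i j
  · exact (this hj hi hij.symm (by omega)).symm
  refine disjoint_left.2 ?_
  rintro _ ⟨a, ha, rfl⟩ ⟨b, hb, hab⟩
  have hret : f^[p - j + i] a ∈ connectedComponentIn W u := by
    rw [Function.iterate_add_apply, ← hab, ← Function.iterate_add_apply, Nat.sub_add_cancel hj.le]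
    exact hp.2.1 hb
  have := hp.2.2 _ (by omega) (mapsTo_iterate_connectedComponentIn_self hf hW ha hret)
  omega

/-- Eventually the orbits of `x` and `y` run through the same components of `W`. -/
def EventuallySynchronized (f : G → G) (W : Set G) (x y : G) : Prop :=
  ∀ᶠ n in atTop, f^[n] x ∈ W ∧ f^[n] y ∈ connectedComponentIn W (f^[n] x)

theorem eventuallySynchronized_of_tendsto {x y z : G} (hf : Continuous f) (hWcl : IsClosed W)
    (hW : MapsTo f W W) {T : Set (Set G)} (hT : T.Finite) (hc : ∀ t ∈ T, IsPreconnected t)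
    (hTW : ⋃₀ T = W) {n : ℕ → ℕ} {j : ℕ} (hz : f^[j] z ∈ interior W)
    (hx : Tendsto (fun k => f^[n k] x) atTop (𝓝 z))
    (hy : Tendsto (fun k => f^[n k] y) atTop (𝓝 z)) : EventuallySynchronized f W x y := by
  have hnhds : connectedComponentIn W (f^[j] z) ∈ 𝓝 (f^[j] z) := by
    have h := connectedComponentIn_mem_nhdsWithin (u := f^[j] z) hWcl hT hc hTW
    rwa [nhdsWithin_eq_nhds.2 (mem_interior_iff_mem_nhds.1 hz)] at h
  have hlim : ∀ {v : G}, Tendsto (fun k => f^[n k] v) atTop (𝓝 z) →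
      ∀ᶠ k in atTop, f^[j + n k] v ∈ connectedComponentIn W (f^[j] z) := by
    intro v hv
    simp only [Function.iterate_add_apply]
    exact (((hf.iterate j).tendsto z).comp hv).eventually hnhds
  obtain ⟨k, hkx, hky⟩ := ((hlim hx).and (hlim hy)).exists
  filter_upwards [eventually_ge_atTop (j + n k)] with m hm
  obtain ⟨e, rfl⟩ := Nat.exists_eq_add_of_le' hm
  have hmaps := mapsTo_iterate_connectedComponentIn hf hW (interior_subset hz) e
  rw [Function.iterate_add_apply, Function.iterate_add_apply f e _ y]
  have hx' := hmaps hkx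
  exact ⟨connectedComponentIn_subset _ _ hx', connectedComponentIn_eq hx' ▸ hmaps hky⟩

variable [CompactSpace G] [T2Space G]

theorem isClosed_componentCore (hf : Continuous f) (hW : IsClosed W) (p : ℕ) :
    IsClosed (componentCore f W u p) :=
  isClosed_iInter fun _ =>
    ((isClosed_connectedComponentIn hW u).isCompact.image (hf.iterate _)).isClosed

theorem isPreconnected_componentCore (hf : Continuous f) (hW : IsClosed W) {p : ℕ}
    (hp : MapsTo f^[p] (connectedComponentIn W u) (connectedComponentIn W u)) :
    IsPreconnected (componentCore f W u p) :=
  isPreconnected_iInter_of_antitone (antitone_image_iterate_mul hp)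
    (fun _ => ((isClosed_connectedComponentIn hW u).isCompact.image (hf.iterate _)).isClosed)
    (fun _ => isPreconnected_connectedComponentIn.image _ (hf.iterate _).continuousOn)

theorem image_componentCore (hf : Continuous f) (hW : IsClosed W) {p : ℕ}
    (hp : MapsTo f^[p] (connectedComponentIn W u) (connectedComponentIn W u)) :
    f^[p] '' componentCore f W u p = componentCore f W u p := by
  have hanti := antitone_image_iterate_mul hp
  rw [componentCore, image_iInter_of_antitone (hf.iterate p) hanti fun _ =>
    ((isClosed_connectedComponentIn hW u).isCompact.image (hf.iterate _)).isClosed]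
  simp only [← image_iterate_add]
  refine Subset.antisymm ?_ ?_
  · refine iInter_mono fun m => ?_
    rw [add_comm, ← Nat.mul_succ]
    exact hanti m.le_succ
  · refine subset_iInter fun m => (iInter_subset _ (m + 1)).trans ?_
    rw [Nat.mul_succ, add_comm]

theorem IsFirstReturn.isPeriodicSubgraph {p : ℕ} (hp : IsFirstReturn f W u p)
    {ι : Type*} [Finite ι] (D : ArcDecomposition G ι)
    (hf : Continuous f) (hWcl : IsClosed W) (hW : MapsTo f W W)
    (hnt : (componentCore f W u p).Nontrivial) :
    IsPeriodicSubgraph f (componentCore f W u p) p := by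
  have hc := isPreconnected_componentCore hf hWcl hp.2.1
  exact ⟨(ArcDecomposition.tame_of_isPreconnected (D := D) hc).isSubgraph
      (isClosed_componentCore hf hWcl p) ⟨hnt.nonempty, hc⟩ hnt, hp.1,
    image_componentCore hf hWcl hp.2.1, fun i j hi hj hij =>
      (hp.disjoint_images hf hW hi hj hij).mono (image_mono (componentCore_subset p))
        (image_mono (componentCore_subset p))⟩

theorem exists_isFirstReturn_of_tendsto {x y x' y' : G} (hf : Continuous f)
    (hWcl : IsClosed W) (hW : MapsTo f W W) {T : Set (Set G)} (hT : T.Finite)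
    (hc : ∀ t ∈ T, IsPreconnected t) (hTW : ⋃₀ T = W) (hsync : EventuallySynchronized f W x y)
    {n : ℕ → ℕ} (hn : Tendsto n atTop atTop)
    (hx : Tendsto (fun k => f^[n k] x) atTop (𝓝 x'))
    (hy : Tendsto (fun k => f^[n k] y) atTop (𝓝 y')) :
    ∃ p, IsFirstReturn f W x' p ∧ x' ∈ componentCore f W x' p ∧
      y' ∈ componentCore f W x' p := by
  have hC : ∀ᶠ k in atTop, f^[n k] x ∈ connectedComponentIn W x' ∧
      f^[n k] y ∈ connectedComponentIn W x' := by
    filter_upwards [hn.eventually hsync,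
      hx.eventually (mem_nhdsWithin_iff_eventually.1
        (connectedComponentIn_mem_nhdsWithin hWcl hT hc hTW))] with k hk hk'
    have hkC := hk' hk.1
    exact ⟨hkC, connectedComponentIn_eq hkC ▸ hk.2⟩
  obtain ⟨k₀, hk₀x, hk₀y⟩ := hC.exists
  obtain ⟨k₁, ⟨hk₁x, -⟩, hk₁⟩ := (hC.and (hn.eventually_gt_atTop (n k₀))).exists
  have hex : ∃ p, 0 < p ∧
      MapsTo f^[p] (connectedComponentIn W x') (connectedComponentIn W x') := by
    refine ⟨n k₁ - n k₀, by omega, mapsTo_iterate_connectedComponentIn_self hf hW hk₀x ?_⟩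
    rwa [← Function.iterate_add_apply, Nat.sub_add_cancel hk₁.le]
  classical
  obtain ⟨hp0, hp⟩ := Nat.find_spec hex
  have hmin : ∀ r, 0 < r →
      MapsTo f^[r] (connectedComponentIn W x') (connectedComponentIn W x') → Nat.find hex ≤ r :=
    fun r h0 hr => Nat.find_min' hex ⟨h0, hr⟩
  generalize Nat.find hex = p at hp0 hp hmin
  have himg : ∀ m, ∀ᶠ k in atTop, f^[n k] x ∈ f^[p * m] '' connectedComponentIn W x' ∧
      f^[n k] y ∈ f^[p * m] '' connectedComponentIn W x' := by
    intro m
    filter_upwards [hC, hn.eventually_ge_atTop (n k₀ + p * m)] with k hk hkn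
    obtain ⟨e, he⟩ := Nat.exists_eq_add_of_le hkn
    have hxe := mapsTo_iterate_mul hp (m + e / p) hk₀x
    have hdvd : e % p = 0 := by
      by_contra hr
      refine absurd (hmin _ (Nat.pos_of_ne_zero hr)
        (mapsTo_iterate_connectedComponentIn_self hf hW hxe ?_)) (Nat.mod_lt e hp0).not_ge
      rw [← Function.iterate_add_apply, ← Function.iterate_add_apply]
      convert hk.1 using 2
      rw [he, mul_add]
      have := Nat.mod_add_div e p
      omega
    have hnk : n k = p * m + (p * (e / p) + n k₀) := by
      have := Nat.mod_add_div e p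
      omega
    rw [hnk]
    simp only [Function.iterate_add_apply]
    exact ⟨mem_image_of_mem _ (mapsTo_iterate_mul hp _ hk₀x),
      mem_image_of_mem _ (mapsTo_iterate_mul hp _ hk₀y)⟩
  have hcl : ∀ m, IsClosed (f^[p * m] '' connectedComponentIn W x') := fun m =>
    ((isClosed_connectedComponentIn hWcl x').isCompact.image (hf.iterate _)).isClosed
  exact ⟨p, ⟨hp0, hp, hmin⟩,
    mem_iInter.2 fun m => (hcl m).mem_of_tendsto hx ((himg m).mono fun _ h => h.1),
    mem_iInter.2 fun m => (hcl m).mem_of_tendsto hy ((himg m).mono fun _ h => h.2)⟩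

end Components

theorem mem_omegaSet_of_tendsto {G : Type*} [TopologicalSpace G] {f : G → G} {x z : G}
    {n : ℕ → ℕ} (hn : Tendsto n atTop atTop) (h : Tendsto (fun k => f^[n k] x) atTop (𝓝 z)) :
    z ∈ omegaSet f x := by
  refine mem_iInter.2 fun N => mem_closure_of_tendsto h ?_
  filter_upwards [hn.eventually_ge_atTop N] with k hk
  exact mem_image_of_mem _ hk

theorem iterate_injective_of_forall_cycle {G : Type*} [TopologicalSpace G] [CompactSpace G]
    [T2Space G] {f : G → G} (hf : Continuous f) {z : G}
    (h : ∀ n, ∃ X k, n ≤ k ∧ IsCycleOfGraphs f X k ∧ ∀ j, f^[j] z ∈ X) :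
    Function.Injective fun j => f^[j] z := by
  intro a b hab
  by_contra hne
  wlog hlt : a < b generalizing a b
  · exact this hab.symm (Ne.symm hne) (by omega)
  obtain ⟨X, k, hk, hX, hz⟩ := h (b - a + 1)
  have hper : f^[b - a] (f^[a] z) = f^[a] z := by
    rw [← Function.iterate_add_apply, Nat.sub_add_cancel hlt.le]
    exact hab.symm
  have := hX.le_of_mapsTo hf isPreconnected_singleton (singleton_nonempty (f^[a] z))
    (singleton_subset_iff.2 (hz a)) (p := b - a) (by omega) (by simpa using hper)
  omega

theorem exists_tendsto_subseq_pair {G : Type*} [TopologicalSpace G] [CompactSpace G]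
    [FirstCountableTopology G] {f : G → G} {x y : G} (n : ℕ → ℕ) :
    ∃ x' y', ∃ r : ℕ → ℕ, StrictMono r ∧ Tendsto (fun k => f^[n (r k)] x) atTop (𝓝 x') ∧
      Tendsto (fun k => f^[n (r k)] y) atTop (𝓝 y') := by
  obtain ⟨⟨x', y'⟩, -, r, hr, hlim⟩ := (isCompact_univ (X := G × G)).tendsto_subseq
    (x := fun k => (f^[n k] x, f^[n k] y)) fun _ => mem_univ _
  rw [nhds_prod_eq] at hlim
  exact ⟨x', y', r, hr, hlim.fst, hlim.snd⟩

/-- If `⟨x,y⟩` is a scrambled pair and `ω_f(x)` is a solenoid, then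
`δ = limsup_n d(f^n x, f^n y) > 0` and there is an NS-pair `⟨x*,y*⟩` with
`d(x*,y*) ≥ δ/2`. -/
theorem scrambled_pair_yields_nsPair {G : Type*} [MetricSpace G]
    (hG : IsTopGraph G) (f : G → G) (hf : Continuous f) (x y : G)
    (hscr : ScrambledPair f x y)
    (hsol : IsSolenoid f (omegaSet f x)) :
    0 < Filter.limsup (fun n => dist (f^[n] x) (f^[n] y)) Filter.atTop ∧
    ∃ x' y' : G, IsNSPair f x' y' ∧
      Filter.limsup (fun n => dist (f^[n] x) (f^[n] y)) Filter.atTop / 2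
        ≤ dist x' y' := by
  have : CompactSpace G := hG.1
  obtain ⟨N, ⟨D⟩⟩ := hG.exists_arcDecomposition
  set δ := limsup (fun n => dist (f^[n] x) (f^[n] y)) atTop
  have hbdd : IsBoundedUnder (· ≤ ·) atTop fun n => dist (f^[n] x) (f^[n] y) :=
    isBoundedUnder_of ⟨Metric.diam (univ : Set G), fun n =>
      Metric.dist_le_diam_of_mem isCompact_univ.isBounded (mem_univ _) (mem_univ _)⟩
  have hcobdd : IsCoboundedUnder (· ≤ ·) atTop fun n => dist (f^[n] x) (f^[n] y) :=
    (isBoundedUnder_of ⟨0, fun n => dist_nonneg⟩ :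
      IsBoundedUnder (· ≥ ·) atTop fun n => dist (f^[n] x) (f^[n] y)).isCoboundedUnder_le
  have hδ : 0 < δ := by
    by_contra hle
    refine hscr.2 (tendsto_order.2 ⟨fun a ha => Eventually.of_forall fun n =>
      ha.trans_le dist_nonneg, fun a ha => ?_⟩)
    exact eventually_lt_of_limsup_lt ((not_lt.1 hle).trans_lt ha) hbdd
  refine ⟨hδ, ?_⟩
  obtain ⟨n₁, hn₁, hfar⟩ := extraction_of_frequently_atTop
    (frequently_lt_of_lt_limsup hcobdd (half_lt_self hδ))
  obtain ⟨x', y', r₁, hr₁, hx', hy'⟩ := exists_tendsto_subseq_pair (f := f) (x := x) (y := y) n₁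
  have hdist : δ / 2 ≤ dist x' y' :=
    ge_of_tendsto (hx'.dist hy') (Eventually.of_forall fun k => (hfar (r₁ k)).le)
  have hne : x' ≠ y' := dist_pos.1 ((half_pos hδ).trans_le hdist)
  have hnr₁ := (hn₁.comp hr₁).tendsto_atTop
  obtain ⟨n₂, hn₂, hnear⟩ := extraction_forall_of_frequently
    (P := fun k n => dist (f^[n] x) (f^[n] y) < 1 / ((k : ℝ) + 1)) fun k =>
      frequently_atTop.2 fun M => hscr.1 _ (by positivity) M
  obtain ⟨z, z', r₂, hr₂, hz, hz'⟩ := exists_tendsto_subseq_pair (f := f) (x := x) (y := y) n₂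
  have hzz' : z = z' := by
    refine dist_le_zero.1 (le_of_tendsto_of_tendsto' (hz.dist hz')
      (tendsto_one_div_add_atTop_nhds_zero_nat.comp hr₂.tendsto_atTop) fun k => ?_)
    exact (hnear (r₂ k)).le
  subst hzz'
  have hzω : ∀ j, f^[j] z ∈ omegaSet f x := fun j => by
    refine mem_omegaSet_of_tendsto (n := fun k => j + n₂ (r₂ k))
      (tendsto_atTop_mono (fun k => Nat.le_add_left _ _) (hn₂.comp hr₂).tendsto_atTop) ?_
    simp only [Function.iterate_add_apply]
    exact ((hf.iterate j).tendsto z).comp hz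
  choose X k hk hX hωX using hsol.2
  have hinj : Function.Injective fun j => f^[j] z := iterate_injective_of_forall_cycle hf fun n =>
    ⟨X n, k n, hk n, hX n, fun j => hωX n (hzω j)⟩
  let W : ℕ → Set G := fun n => ⋂ i ∈ Finset.range (n + 1), X i
  have hWX : ∀ n, W n ⊆ X n := fun n => biInter_subset_of_mem (by simp)
  have hWanti : ∀ n, W (n + 1) ⊆ W n := fun n =>
    biInter_subset_biInter_left (Finset.range_mono (n + 1).le_succ)
  have hWcl : ∀ n, IsClosed (W n) := fun n => isClosed_biInter fun i _ => (hX i).isClosed hf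
  have hW : ∀ n, MapsTo f (W n) (W n) := fun n u hu => mem_iInter₂.2 fun i hi =>
    (hX i).mapsTo (mem_iInter₂.1 hu i hi)
  have hWtame : ∀ n, D.Tame (W n) := fun n =>
    ArcDecomposition.tame_biInter_range (fun i => (hX i).tame hf D) _
  have hreturn : ∀ n, ∃ p, IsFirstReturn f (W n) x' p ∧ x' ∈ componentCore f (W n) x' p ∧
      y' ∈ componentCore f (W n) x' p := by
    intro n
    obtain ⟨T, hT, hc, hTW⟩ := (hWtame n).exists_preconnected
    obtain ⟨j, hj⟩ : ∃ j, f^[j] z ∈ interior (W n) := by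
      by_contra! hcon
      refine infinite_range_of_injective hinj ((hWtame n).finite_diff_interior.subset ?_)
      rintro _ ⟨j, rfl⟩
      exact ⟨mem_iInter₂.2 fun i _ => hωX i (hzω j), hcon j⟩
    exact exists_isFirstReturn_of_tendsto hf (hWcl n) (hW n) hT hc hTW
      (eventuallySynchronized_of_tendsto hf (hWcl n) (hW n) hT hc hTW hj hz hz') hnr₁ hx' hy'
  choose p hp hxp hyp using hreturn
  refine ⟨x', y', ⟨hne, mem_iUnion.2 ⟨x, mem_omegaSet_of_tendsto hnr₁ hx'⟩,
    mem_iUnion.2 ⟨y, mem_omegaSet_of_tendsto hnr₁ hy'⟩,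
    fun n => componentCore f (W n) x' (p n), p,
    fun n => (hp n).isPeriodicSubgraph D hf (hWcl n) (hW n) ⟨x', hxp n, y', hyp n, hne⟩,
    fun n => componentCore_anti (hWanti n) (hp (n + 1)).1 (hp n).2.1,
    tendsto_atTop_mono (fun n => (hk n).trans ?_) tendsto_id,
    fun n => ⟨hxp n, hyp n⟩⟩, hdist⟩
  exact (hX n).le_of_mapsTo hf isPreconnected_connectedComponentIn
    ⟨x', componentCore_subset _ (hxp n)⟩
    ((connectedComponentIn_subset _ _).trans (hWX n)) (hp n).1 (hp n).2.1
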